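/- Let c, d be relatively prime integers with 0 < c < d, and let n ≥ 1 be an integer. Suppose d/c = [n_1,…,n_{j−1}]⁻ and d/(d−c) = [n_k, n_{k−1},…,n_{j+1}]⁻ are the Hirzebruch–Jung continued fraction expansions with all entries integers ≥ 2. Then [n_1,…,n_{j−1}, n+1, n_{j+1},…,n_k]⁻ = n d² / (n d c + 1). -/

import Mathlib

/-- Hirzebruch–Jung continued fraction `[x_1, …, x_k]⁻`,
defined recursively by `[x_k]⁻ = x_k` and `[x_1,…,x_k]⁻ = x_1 − 1/[x_2,…,x_k]⁻`. -/
noncomputable def hj : List ℝ → ℝ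
  | [] => 0
  | [x] => x
  | x :: y :: l => x - 1 / hj (y :: l)

/-- The predicate asserting that the Hirzebruch–Jung continued fraction of a
(nonempty) tuple is defined, i.e. no division by zero occurs in the recursion. -/
noncomputable def hjDef : List ℝ → Prop
  | [] => False
  | [_] => True
  | _ :: y :: l => hjDef (y :: l) ∧ hj (y :: l) ≠ 0

theorem hj_cons {l : List ℝ} (x : ℝ) (hl : l ≠ []) : hj (x :: l) = x - 1 / hj l := by
  cases l with
  | nil => exact absurd rfl hl
  | cons y l => rfl

theorem hjDef_cons {l : List ℝ} (x : ℝ) (h : hjDef l) (h0 : hj l ≠ 0) : hjDef (x :: l) := by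
  cases l with
  | nil => trivial
  | cons y l => exact ⟨h, h0⟩

theorem hjDef.ne_nil {l : List ℝ} (h : hjDef l) : l ≠ [] := by
  rintro rfl
  exact h

/-- The action on integer vectors of the product of the matrices `!![x, -1; 1, 0]`,
`x` running through a list. -/
def hjAct : List ℤ → ℤ × ℤ → ℤ × ℤ
  | [], v => v
  | x :: l, v => (x * (hjAct l v).1 - (hjAct l v).2, (hjAct l v).1)

theorem hjAct_append (l m : List ℤ) (v : ℤ × ℤ) : hjAct (l ++ m) v = hjAct l (hjAct m v) := by
  induction l with
  | nil => rfl
  | cons x l ih => simp [hjAct, ih]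

/-- Coefficients of `hjAct l`. Reversing the list transposes the matrix up to signs. -/
theorem exists_hjAct_coeff (l : List ℤ) (hl : ∀ x ∈ l, 2 ≤ x) :
    ∃ p p' q q' : ℤ, (∀ a b, hjAct l (a, b) = (p * a - p' * b, q * a - q' * b)) ∧
      (∀ a b, hjAct l.reverse (a, b) = (p * a - q * b, p' * a - q' * b)) ∧
      p' * q - p * q' = 1 ∧ 0 ≤ q ∧ q < p ∧ 0 ≤ p' ∧ q' < p' ∧ p' < p ∧
      q - q' ≤ p - p' := by
  induction l with
  | nil => exact ⟨1, 0, 0, -1, by simp [hjAct], by simp [hjAct], by norm_num⟩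
  | cons x l ih =>
    obtain ⟨p, p', q, q', h, hr, hdet, hq, hqp, hp', hqp', hpp', hd⟩ :=
      ih fun y hy => hl y (List.mem_cons_of_mem x hy)
    have hx : 2 ≤ x := hl x List.mem_cons_self
    refine ⟨x * p - q, x * p' - q', p, p', fun a b => ?_, fun a b => ?_, ?_, ?_, ?_, ?_, ?_, ?_, ?_⟩
    · simp only [hjAct, h, Prod.mk.injEq, and_true]
      ring
    · simp only [List.reverse_cons, hjAct_append, hjAct, hr, Prod.mk.injEq]
      constructor <;> ring
    · linear_combination hdet
    all_goals nlinarith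

/-- Prepending entries `≥ 2` to a tuple of value `a / b ≥ 1`. -/
theorem hj_append (u : List ℤ) (hu : ∀ x ∈ u, 2 ≤ x) (v : List ℝ) (hv : hjDef v) (a b : ℤ)
    (hb : 0 < b) (hab : b ≤ a) (h : hj v = a / b) :
    hjDef (u.map Int.cast ++ v) ∧
      hj (u.map Int.cast ++ v) = (hjAct u (a, b)).1 / (hjAct u (a, b)).2 ∧
      0 < (hjAct u (a, b)).2 ∧ (hjAct u (a, b)).2 ≤ (hjAct u (a, b)).1 := by
  induction u with
  | nil => exact ⟨hv, h, hb, hab⟩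
  | cons x u ih =>
    obtain ⟨hdef, hval, hpos, hle⟩ := ih fun y hy => hu y (List.mem_cons_of_mem x hy)
    have hx : 2 ≤ x := hu x List.mem_cons_self
    simp only [List.map_cons, List.cons_append, hjAct]
    generalize (hjAct u (a, b)).1 = p at *
    generalize (hjAct u (a, b)).2 = q at *
    have hp : 0 < p := hpos.trans_le hle
    have hpR : (0 : ℝ) < p := by exact_mod_cast hp
    have hqR : (0 : ℝ) < q := by exact_mod_cast hpos
    refine ⟨hjDef_cons _ hdef ?_, ?_, hp, by nlinarith⟩
    · rw [hval]
      positivity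
    · rw [hj_cons _ hdef.ne_nil, hval]
      push_cast
      field_simp

theorem hj_map_cast (u : List ℤ) (hu : ∀ x ∈ u, 2 ≤ x) (hne : u ≠ []) :
    hjDef (u.map Int.cast) ∧
      hj (u.map Int.cast) = (hjAct u (1, 0)).1 / (hjAct u (1, 0)).2 ∧
      0 < (hjAct u (1, 0)).2 := by
  induction u using List.reverseRecOn with
  | nil => exact absurd rfl hne
  | append_singleton l x _ =>
    have hx : 2 ≤ x := hu x (by simp)
    have := hj_append l (fun y hy => hu y (List.mem_append_left _ hy)) [(x : ℝ)] trivial x 1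
      one_pos (by linarith) (by simp [hj])
    simpa [hjAct_append, hjAct] using ⟨this.1, this.2.1, this.2.2.1⟩

theorem Int.eq_of_isCoprime_of_div_eq_div {p q c d : ℤ} (hpq : IsCoprime p q) (hcd : IsCoprime d c)
    (hp : 0 < p) (hq : 0 < q) (hc : 0 < c) (hd : 0 < d) (h : (p : ℝ) / q = d / c) :
    p = d ∧ q = c := by
  have hqR : (q : ℝ) ≠ 0 := by exact_mod_cast hq.ne'
  have hcR : (c : ℝ) ≠ 0 := by exact_mod_cast hc.ne'
  rw [div_eq_div_iff hqR hcR] at h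
  have h : p * c = d * q := by exact_mod_cast h
  have hpd : p = d := Int.dvd_antisymm hp.le hd.le
    (hpq.dvd_of_dvd_mul_right (Dvd.intro _ h)) (hcd.dvd_of_dvd_mul_right (Dvd.intro _ h.symm))
  subst hpd
  exact ⟨rfl, (mul_left_cancel₀ hp.ne' h).symm⟩

/-- The matrix of `hjAct u` when `u` is the expansion of the reduced fraction `d / c`;
`c'` is the inverse of `c` modulo `d`. -/
theorem exists_hjAct_of_hj_eq (u : List ℤ) (hu : ∀ x ∈ u, 2 ≤ x) {c d : ℤ} (hc : 0 < c)
    (hd : 0 < d) (hco : IsCoprime d c) (h : hj (u.map Int.cast) = (d : ℝ) / c) :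
    u ≠ [] ∧ ∃ c' r : ℤ, (∀ a b, hjAct u (a, b) = (d * a - c' * b, c * a - r * b)) ∧
      (∀ a b, hjAct u.reverse (a, b) = (d * a - c * b, c' * a - r * b)) ∧
      c' * c - d * r = 1 ∧ 0 ≤ c' ∧ c' < d := by
  have hne : u ≠ [] := by
    rintro rfl
    have hcR : (0 : ℝ) < c := by exact_mod_cast hc
    have hdR : (0 : ℝ) < d := by exact_mod_cast hd
    exact (div_pos hdR hcR).ne h
  obtain ⟨p, p', q, q', hact, hrev, hdet, hq, hqp, hp', -, hpp', -⟩ := exists_hjAct_coeff u hu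
  obtain ⟨-, hval, hpos⟩ := hj_map_cast u hu hne
  simp only [hact, mul_one, mul_zero, sub_zero] at hval hpos
  obtain ⟨rfl, rfl⟩ := Int.eq_of_isCoprime_of_div_eq_div (p := p) (q := q)
    ⟨-q', p', by linear_combination hdet⟩ hco (hq.trans_lt hqp) hpos hc hd (hval.symm.trans h)
  exact ⟨hne, p', q', hact, hrev, hdet, hp', hpp'⟩

/-- Let `c, d` be relatively prime integers with `0 < c < d` and let `n ≥ 1` be
an integer. If `d/c = [n_1,…,n_{j−1}]⁻` and `d/(d−c) = [n_k,…,n_{j+1}]⁻` are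
Hirzebruch–Jung continued fraction expansions with all entries integers `≥ 2`
(here `u = (n_1,…,n_{j−1})` and `w = (n_k,…,n_{j+1})`), then
`[n_1,…,n_{j−1}, n+1, n_{j+1},…,n_k]⁻ = n d² / (n d c + 1)`. -/
theorem stmt_19 (c d : ℤ) (hc : 0 < c) (hcd : c < d) (hco : IsCoprime c d)
    (n : ℤ) (hn : 1 ≤ n) (u w : List ℤ)
    (hu2 : ∀ x ∈ u, 2 ≤ x) (hw2 : ∀ x ∈ w, 2 ≤ x)
    (hu : hj (u.map Int.cast) = (d : ℝ) / (c : ℝ))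
    (hw : hj (w.map Int.cast) = (d : ℝ) / ((d : ℝ) - (c : ℝ))) :
    hjDef ((u ++ (n + 1) :: w.reverse).map Int.cast) ∧
      hj ((u ++ (n + 1) :: w.reverse).map Int.cast) =
        (n : ℝ) * (d : ℝ) ^ 2 / ((n : ℝ) * (d : ℝ) * (c : ℝ) + 1) := by
  have hd : 0 < d := hc.trans hcd
  obtain ⟨-, c', r, hactu, -, hdetu, hc_nonneg, hc_lt⟩ :=
    exists_hjAct_of_hj_eq u hu2 hc hd hco.symm hu
  have hco' : IsCoprime d (d - c) := by
    obtain ⟨a, b, hab⟩ := hco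
    exact ⟨a + b, -a, by linear_combination hab⟩
  obtain ⟨hwne, e', s, -, hrevw, hdetw, he_nonneg, he_lt⟩ :=
    exists_hjAct_of_hj_eq w hw2 (sub_pos.2 hcd) hd hco' (by rw [hw]; push_cast; rfl)
  have hsum : c' + e' = d := by
    have hdvd : d ∣ c' + e' := hco.symm.dvd_of_dvd_mul_left
      ⟨r + e' - s, by linear_combination hdetu - hdetw⟩
    obtain ⟨k, hk⟩ := hdvd
    have hk2 : k < 2 := by nlinarith
    have hk0 : 0 < k := by
      by_contra! hk0
      have hc' : c' = 0 := by nlinarith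
      subst hc'
      have : d ∣ 1 := ⟨-r, by linear_combination -hdetu⟩
      linarith [Int.le_of_dvd one_pos this]
    obtain rfl : k = 1 := by omega
    linarith
  obtain ⟨hdefw, hvalw, hposw⟩ :=
    hj_map_cast w.reverse (fun x hx => hw2 x (List.mem_reverse.1 hx)) (by simpa using hwne)
  simp only [hrevw, mul_one, mul_zero, sub_zero] at hvalw hposw
  have hdR : (0 : ℝ) < d := by exact_mod_cast hd
  have heR : (0 : ℝ) < e' := by exact_mod_cast hposw
  have hne : hj (w.reverse.map Int.cast) ≠ 0 := by
    rw [hvalw]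
    positivity
  have htail : hj (((n + 1 : ℤ) : ℝ) :: w.reverse.map Int.cast) = ((n * d + c' : ℤ) : ℝ) / d := by
    rw [hj_cons _ hdefw.ne_nil, hvalw]
    push_cast
    field_simp
    have : (c' : ℝ) + e' = d := by exact_mod_cast hsum
    linear_combination -this
  obtain ⟨hdef, hval, -⟩ := hj_append u hu2 _ (hjDef_cons ((n + 1 : ℤ) : ℝ) hdefw hne)
    (n * d + c') d hd (by nlinarith) htail
  rw [List.map_append, List.map_cons]
  refine ⟨hdef, hval.trans ?_⟩
  rw [hactu]
  have h1 : d * (n * d + c') - c' * d = n * d ^ 2 := by ring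
  have h2 : c * (n * d + c') - r * d = n * d * c + 1 := by linear_combination hdetu
  simp only [h1, h2]
  push_cast
  rfl
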